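/- (Stability of finite monoids) Let M be a finite monoid and a, b ∈ M. If a·b and a generate the same two-sided principal ideal, i.e., {u·(a·b)·v | u, v ∈ M} = {u·a·v | u, v ∈ M}, then (a·b)·M = a·M. Dually, if {u·(b·a)·v | u, v ∈ M} = {u·a·v | u, v ∈ M}, then M·(b·a) = M·a. -/

import Mathlib

theorem eq_pow_mul_mul_pow {M : Type*} [Monoid M] {a u c : M} (h : u * a * c = a) (n : ℕ) :
    u ^ n * a * c ^ n = a := by
  induction n with
  | zero => simp
  | succ n ih =>
    calc u ^ (n + 1) * a * c ^ (n + 1) = u ^ n * (u * a * c) * c ^ n := by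
          rw [pow_succ, pow_succ']; simp only [mul_assoc]
      _ = a := by rw [h, ih]

theorem exists_mul_mul_eq_self_right {M : Type*} [Monoid M] [Finite M] {a u c : M}
    (h : u * a * c = a) : ∃ m, a * c * m = a := by
  obtain ⟨i, j, hij, hc⟩ : ∃ i j, i < j ∧ c ^ i = c ^ j := by
    obtain ⟨i, j, hne, hc⟩ := Finite.exists_ne_map_eq_of_infinite (fun n : ℕ => c ^ n)
    rcases lt_or_gt_of_ne hne with hlt | hlt
    exacts [⟨i, j, hlt, hc⟩, ⟨j, i, hlt, hc.symm⟩]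
  obtain ⟨k, rfl⟩ := Nat.exists_eq_add_of_lt hij
  refine ⟨c ^ k, ?_⟩
  calc a * c * c ^ k = u ^ i * a * c ^ i * c * c ^ k := by rw [eq_pow_mul_mul_pow h]
    _ = u ^ i * a * c ^ (i + k + 1) := by
      rw [add_assoc, pow_add, pow_succ' c k]; simp only [mul_assoc]
    _ = a := by rw [← hc, eq_pow_mul_mul_pow h]

theorem exists_mul_mul_eq_self_left {M : Type*} [Monoid M] [Finite M] {a u c : M}
    (h : u * a * c = a) : ∃ m, m * (u * a) = a := by
  have : Finite Mᵐᵒᵖ := .of_equiv M MulOpposite.opEquiv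
  obtain ⟨m, hm⟩ := exists_mul_mul_eq_self_right (M := Mᵐᵒᵖ)
    (a := .op a) (u := .op c) (c := .op u)
    (MulOpposite.unop_injective (by simpa [mul_assoc] using h))
  exact ⟨m.unop, by simpa using congrArg MulOpposite.unop hm⟩

/-- stability of finite monoids: in a finite monoid, if `a·b` and `a` generate
the same two-sided principal ideal then `(a·b)M = aM`; dually, if `b·a` and `a` generate the
same two-sided principal ideal then `M(b·a) = Ma`. -/
theorem stability_finite_monoid (M : Type) [Monoid M] [Finite M] (a b : M) :
    ({x : M | ∃ u v : M, x = u * (a * b) * v} = {x : M | ∃ u v : M, x = u * a * v} →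
      {x : M | ∃ m : M, x = (a * b) * m} = {x : M | ∃ m : M, x = a * m}) ∧
    ({x : M | ∃ u v : M, x = u * (b * a) * v} = {x : M | ∃ u v : M, x = u * a * v} →
      {x : M | ∃ m : M, x = m * (b * a)} = {x : M | ∃ m : M, x = m * a}) := by
  have mem_self : a ∈ {x : M | ∃ u v : M, x = u * a * v} := ⟨1, 1, by simp⟩
  constructor
  · intro h
    obtain ⟨u, v, huv⟩ := h.symm ▸ mem_self
    obtain ⟨m, hm⟩ := exists_mul_mul_eq_self_right (a := a) (u := u) (c := b * v)
      (by simpa only [mul_assoc] using huv.symm)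
    ext x
    constructor
    · rintro ⟨n, rfl⟩
      exact ⟨b * n, mul_assoc a b n⟩
    · rintro ⟨n, rfl⟩
      refine ⟨v * m * n, ?_⟩
      conv_lhs => rw [← hm]
      simp only [mul_assoc]
  · intro h
    obtain ⟨u, v, huv⟩ := h.symm ▸ mem_self
    obtain ⟨m, hm⟩ := exists_mul_mul_eq_self_left (a := a) (u := u * b) (c := v)
      (by simpa only [mul_assoc] using huv.symm)
    ext x
    constructor
    · rintro ⟨n, rfl⟩
      exact ⟨n * b, (mul_assoc n b a).symm⟩
    · rintro ⟨n, rfl⟩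
      refine ⟨n * m * u, ?_⟩
      conv_lhs => rw [← hm]
      simp only [mul_assoc]
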